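/- Fix d ≥ 2. Then M · X · M† = ω · (X · Z³ · S³), where M† is the conjugate transpose of M and ω = exp(2πi/d) multiplies the matrix as a scalar. Equivalently, for all x ∈ ZMod d, the (x+1, x) entry of M·X·M† equals ω^{3x²+3x+1} and all other entries vanish. -/

import Mathlib

open Matrix

/-- The phase `ω^a = exp(2πi·a.val/d)` for `a : ZMod d`. -/
noncomputable def zmodPhase (d : ℕ) (a : ZMod d) : ℂ :=
  Complex.exp (2 * Real.pi * Complex.I * a.val / d)

/-- The qudit Pauli `X` gate: `X(y,x) = 1` iff `y = x + 1`. -/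
def Xgate (d : ℕ) : Matrix (ZMod d) (ZMod d) ℂ :=
  Matrix.of fun y x => if y = x + 1 then 1 else 0

/-- The qudit Pauli `Z` gate: diagonal with `Z(x,x) = ω^x`. -/
noncomputable def Zgate (d : ℕ) : Matrix (ZMod d) (ZMod d) ℂ :=
  Matrix.of fun y x => if y = x then zmodPhase d x else 0

/-- The qudit phase gate `S`: diagonal with `S(x,x) = ω^(x²)`. -/
noncomputable def Sgate (d : ℕ) : Matrix (ZMod d) (ZMod d) ℂ :=
  Matrix.of fun y x => if y = x then zmodPhase d (x ^ 2) else 0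

/-- The qudit magic gate `M`: diagonal with `M(x,x) = ω^(x³)`. -/
noncomputable def Mgate (d : ℕ) : Matrix (ZMod d) (ZMod d) ℂ :=
  Matrix.of fun y x => if y = x then zmodPhase d (x ^ 3) else 0

/-- The product operator `P_l`: `P_l(y,x) = 1` iff `y = l·x`. -/
def Pgate (d : ℕ) (l : (ZMod d)ˣ) : Matrix (ZMod d) (ZMod d) ℂ :=
  Matrix.of fun y x => if y = (l : ZMod d) * x then 1 else 0

theorem zmodPhase_eq_std (d : ℕ) [NeZero d] (a : ZMod d) :
    zmodPhase d a = ZMod.stdAddChar a := by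
  rw [ZMod.stdAddChar_apply, ZMod.toCircle_apply, zmodPhase]

theorem zmodPhase_conj_std (d : ℕ) [NeZero d] (a : ZMod d) :
    star (ZMod.stdAddChar a : ℂ) = ZMod.stdAddChar (-a) := by
  rw [ZMod.stdAddChar_apply, ZMod.stdAddChar_apply, AddChar.map_neg_eq_inv, Circle.coe_inv_eq_conj]
  rfl

theorem exp_eq_std (d : ℕ) [NeZero d] :
    Complex.exp (2 * Real.pi * Complex.I / d) = ZMod.stdAddChar (1 : ZMod d) := by
  have := ZMod.stdAddChar_coe (N := d) 1
  simpa using this.symm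

theorem Zgate_diag (d : ℕ) [NeZero d] :
    Zgate d = Matrix.diagonal fun x => (ZMod.stdAddChar x : ℂ) := by
  ext y x
  by_cases h : y = x
  · subst h; simp [Zgate, zmodPhase_eq_std]
  · simp [Zgate, h]

theorem Sgate_diag (d : ℕ) [NeZero d] :
    Sgate d = Matrix.diagonal fun x => (ZMod.stdAddChar (x ^ 2) : ℂ) := by
  ext y x
  by_cases h : y = x
  · subst h; simp [Sgate, zmodPhase_eq_std]
  · simp [Sgate, h]

theorem Mgate_diag (d : ℕ) [NeZero d] :
    Mgate d = Matrix.diagonal fun x => (ZMod.stdAddChar (x ^ 3) : ℂ) := by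
  ext y x
  by_cases h : y = x
  · subst h; simp [Mgate, zmodPhase_eq_std]
  · simp [Mgate, h]

theorem Mgate_conj_Xgate (d : ℕ) [NeZero d] (hd : 2 ≤ d) :
    Mgate d * Xgate d * (Mgate d)ᴴ =
      Complex.exp (2 * Real.pi * Complex.I / d) •
        (Xgate d * Zgate d ^ 3 * Sgate d ^ 3) := by
  rw [Mgate_diag, Zgate_diag, Sgate_diag, exp_eq_std, Matrix.diagonal_conjTranspose,
    Matrix.diagonal_pow, Matrix.diagonal_pow]
  ext y x
  rw [Matrix.smul_apply, Matrix.mul_diagonal, Matrix.mul_diagonal, Matrix.mul_diagonal,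
    Matrix.diagonal_mul]
  by_cases h : y = x + 1
  · subst h
    simp only [Xgate, Matrix.of_apply, if_true, Pi.star_apply, Pi.pow_apply, zmodPhase_conj_std,
      smul_eq_mul, mul_one, one_mul, ← AddChar.map_nsmul_eq_pow, ← AddChar.map_add_eq_mul]
    congr 1
    simp only [nsmul_eq_mul]
    push_cast
    ring
  · simp [Xgate, h]
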